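/- arXiv:2211.05126 — 9 statements merged into one kernel-verified Lean document; each statement's English description precedes it below -/
import Mathlib

section
/- The left translate of w(s⁻¹) by s is the complement of w(s); that is, s·w(s⁻¹) = F ∖ w(s) = {1} ∪ w(s⁻¹) ∪ w(t) ∪ w(t⁻¹). -/
/-- `w u` : the set of elements of the free group `FreeGroup (Fin 2)` whose reduced
word begins on the left with the letter `u` (a generator together with a sign). -/
def w (u : Fin 2 × Bool) : Set (FreeGroup (Fin 2)) :=
  {g : FreeGroup (Fin 2) | g.toWord.head? = some u}

theorem FreeGroup.head?_toWord_mk_singleton_mul {α : Type*} [DecidableEq α] (a : α) (b : Bool)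
    (g : FreeGroup α) :
    (FreeGroup.mk [(a, b)] * g).toWord.head? = some (a, b) ↔
      g.toWord.head? ≠ some (a, !b) := by
  have hg : FreeGroup.IsReduced g.toWord := FreeGroup.isReduced_toWord
  have hmul : (FreeGroup.mk [(a, b)] * g).toWord = FreeGroup.reduce ((a, b) :: g.toWord) := by
    rw [FreeGroup.toWord_mul, FreeGroup.toWord_mk, FreeGroup.reduce_singleton,
      List.singleton_append]
  rw [hmul, FreeGroup.reduce.cons, FreeGroup.reduce_toWord]
  clear hmul
  generalize g.toWord = L at hg ⊢
  rcases L with - | ⟨⟨c, d⟩, - | ⟨⟨e, f⟩, l⟩⟩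
  · simp
  · cases b <;> cases d <;> by_cases h : a = c <;> simp [h, eq_comm]
  · rw [FreeGroup.isReduced_cons_cons] at hg
    dsimp only
    cases b <;> cases d <;> grind

/-- with `s = FreeGroup.of 0`, the left translate `s · w(s⁻¹)` equals the
complement of `w(s)`, which is `{1} ∪ w(s⁻¹) ∪ w(t) ∪ w(t⁻¹)`. -/
theorem s_mul_w_sinv_eq_compl_w_s :
    (FreeGroup.of (0 : Fin 2) * ·) '' w (0, false) = Set.univ \ w (0, true) ∧
    Set.univ \ w (0, true) =
      {(1 : FreeGroup (Fin 2))} ∪ w (0, false) ∪ w (1, true) ∪ w (1, false) := by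
  constructor
  · ext g
    rw [Set.image_mul_left]
    simpa [w, FreeGroup.of, FreeGroup.inv_mk, FreeGroup.invRev] using
      FreeGroup.head?_toWord_mk_singleton_mul (0 : Fin 2) false g
  · ext g
    simp only [w, Set.mem_sdiff, Set.mem_univ, true_and, Set.mem_union, Set.mem_singleton_iff,
      Set.mem_ofPred_eq, ← FreeGroup.toWord_eq_nil_iff]
    rcases g.toWord with - | ⟨⟨c, d⟩, l⟩
    · simp
    · fin_cases c <;> cases d <;> simp
end

section
/- The left translate of w(t⁻¹) by t is the complement of w(t); that is, t·w(t⁻¹) = F ∖ w(t) = {1} ∪ w(s) ∪ w(s⁻¹) ∪ w(t⁻¹). -/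
theorem FreeGroup.head?_toWord_of_inv_mul_eq_iff {α : Type*} [DecidableEq α] (a : α)
    (g : FreeGroup α) :
    ((FreeGroup.of a)⁻¹ * g).toWord.head? = some (a, false) ↔
      g.toWord.head? ≠ some (a, true) := by
  have hred : FreeGroup.IsReduced g.toWord := FreeGroup.isReduced_toWord
  have hword : ((FreeGroup.of a)⁻¹ * g).toWord = FreeGroup.reduce ((a, false) :: g.toWord) := by
    rw [FreeGroup.toWord_mul, FreeGroup.toWord_inv, FreeGroup.toWord_of]
    rfl
  rw [hword, FreeGroup.reduce.cons, FreeGroup.reduce_toWord]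
  rcases hL : g.toWord with _ | ⟨⟨b, c⟩, tl⟩
  · simp
  · rw [hL] at hred
    rcases tl with _ | ⟨⟨d, e⟩, tl⟩
    · grind
    · rw [FreeGroup.isReduced_cons_cons] at hred
      grind

/-- with `t = FreeGroup.of 1`, the left translate `t · w(t⁻¹)` equals the
complement of `w(t)`, which is `{1} ∪ w(s) ∪ w(s⁻¹) ∪ w(t⁻¹)`. -/
theorem t_mul_w_tinv_eq_compl_w_t :
    (FreeGroup.of (1 : Fin 2) * ·) '' w (1, false) = Set.univ \ w (1, true) ∧
    Set.univ \ w (1, true) =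
      {(1 : FreeGroup (Fin 2))} ∪ w (0, true) ∪ w (0, false) ∪ w (1, false) := by
  constructor
  · ext g
    simpa [w] using FreeGroup.head?_toWord_of_inv_mul_eq_iff 1 g
  · ext g
    simp only [w, Set.mem_sdiff, Set.mem_univ, true_and, Set.mem_union, Set.mem_singleton_iff,
      Set.mem_ofPred_eq, ← FreeGroup.toWord_eq_nil_iff]
    rcases g.toWord with _ | ⟨⟨i, b⟩, tl⟩
    · simp
    · fin_cases i <;> cases b <;> simp
end

section
/- The intersection over all positive integers n of the sets w(t⁻¹) ∪ tⁿ·w(t) ∪ {tⁿ} equals w(t⁻¹); that is, ⋂_{n=1}^{∞} ( w(t⁻¹) ∪ tⁿ·w(t) ∪ {tⁿ} ) = w(t⁻¹). -/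
theorem FreeGroup.toWord_of_pow_mul {α : Type*} [DecidableEq α] {a : α} {g : FreeGroup α}
    (hg : g.toWord.head? = some (a, true)) (n : ℕ) :
    (FreeGroup.of a ^ n * g).toWord = List.replicate n (a, true) ++ g.toWord := by
  rw [FreeGroup.toWord_mul, FreeGroup.toWord_of_pow]
  refine FreeGroup.IsReduced.reduce_eq (List.isChain_append.2
    ⟨List.isChain_replicate_of_rel n fun _ => rfl, FreeGroup.isReduced_toWord, ?_⟩)
  intro x hx y hy _
  have hx' := List.eq_of_mem_replicate (List.mem_of_getLast? hx)
  simp_all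

/-- with `t = FreeGroup.of 1`, the intersection over all positive
integers `n` of the sets `w(t⁻¹) ∪ tⁿ · w(t) ∪ {tⁿ}` equals `w(t⁻¹)`. -/
theorem iInter_w_tinv_union_tn_w_t :
    ⋂ (n : ℕ) (_ : 1 ≤ n),
        (w (1, false) ∪ (FreeGroup.of (1 : Fin 2) ^ n * ·) '' w (1, true) ∪
          {FreeGroup.of (1 : Fin 2) ^ n}) =
      w (1, false) := by
  refine Set.Subset.antisymm (fun g hg => ?_)
    (Set.subset_iInter₂ fun n _ x hx => Or.inl (Or.inl hx))
  rcases Set.mem_iInter₂.1 hg (g.norm + 1) (Nat.le_add_left 1 _) with (h | ⟨x, hx, hxg⟩) | h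
  · exact h
  · have hlen := congrArg List.length (FreeGroup.toWord_of_pow_mul hx (g.norm + 1))
    rw [show FreeGroup.of (1 : Fin 2) ^ (g.norm + 1) * x = g from hxg, List.length_append,
      List.length_replicate] at hlen
    change g.norm = _ at hlen
    omega
  · have hnorm := congrArg FreeGroup.norm (Set.mem_singleton_iff.1 h)
    rw [FreeGroup.norm_of_pow] at hnorm
    omega
end

section
/- Suppose the colouring c : X → ℤ/3ℤ obeys the Example-1 rule at every point of X. Then: (a) for every x ∈ X, c(x) = c(τ⁻¹x) + 1 (equivalently, c(τx) = c(x) + 1 for every x); and (b) for every x ∈ X and every j ∈ {1, …, k−1}, if c(x) = 0 then c(σⱼx) ≠ 0, and if c(x) ≠ 0 then c(σⱼx) = 0. -/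
/-- The Example-1 colouring rule at a point `x`.  Colours are elements of `ZMod 3`
(colour `A₁` is `0`).  Let `i = c(τ⁻¹x)`.  If `c(τx) = i` or `c(τx) = i+1` then `x`
must be coloured `i+1`.  If `c(τx) = i-1` then, letting `N` be the number of points
among the `k+1` points `τx, τ⁻¹x, σ₁x, …, σ_{k-1}x` coloured `0`, `x` must be
coloured `c(τx)` whenever `0 < N < k`, and `i+1` otherwise. -/
def ObeysRule {k : ℕ} {X : Type*} (τ : Equiv.Perm X) (σ : Fin (k - 1) → Equiv.Perm X)
    (c : X → ZMod 3) (x : X) : Prop :=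
  let i : ZMod 3 := c (τ.symm x)
  let N : ℕ := (if c (τ x) = 0 then 1 else 0) + (if c (τ.symm x) = 0 then 1 else 0) +
    (Finset.univ.filter fun j : Fin (k - 1) => c (σ j x) = 0).card
  ((c (τ x) = i ∨ c (τ x) = i + 1) → c x = i + 1) ∧
  (c (τ x) = i - 1 →
    ((0 < N ∧ N < k) → c x = c (τ x)) ∧ (¬ (0 < N ∧ N < k) → c x = i + 1))

/-- Two points adjacent in the `τ` direction never share a colour. -/
theorem ObeysRule.apply_ne_apply_symm {k : ℕ} {X : Type*} {τ : Equiv.Perm X}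
    {σ : Fin (k - 1) → Equiv.Perm X} {c : X → ZMod 3} {x : X} (h : ObeysRule τ σ c x) :
    c x ≠ c (τ.symm x) := by
  obtain ⟨h₁, h₂⟩ := h
  intro heq
  have key : ∀ i n : ZMod 3, (n = i ∨ n = i + 1) ∨ (n = i - 1 ∧ i ≠ n) := by decide
  have hsucc : ∀ i : ZMod 3, i ≠ i + 1 := by decide
  rcases key (c (τ.symm x)) (c (τ x)) with hn | ⟨hn, hne⟩
  · exact hsucc _ (heq.symm.trans (h₁ hn))
  · obtain ⟨h₃, h₄⟩ := h₂ hn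
    rcases Classical.em _ with hN | hN
    · exact hne (heq.symm.trans (h₃ hN))
    · exact hsucc _ (heq.symm.trans (h₄ hN))

/-- Unless the next point repeats the colour of `x`, the colour of `x` is the successor of
the previous one. -/
theorem ObeysRule.eq_add_one {k : ℕ} {X : Type*} {τ : Equiv.Perm X}
    {σ : Fin (k - 1) → Equiv.Perm X} {c : X → ZMod 3} {x : X} (h : ObeysRule τ σ c x)
    (hne : c (τ x) ≠ c x) : c x = c (τ.symm x) + 1 := by
  obtain ⟨h₁, h₂⟩ := h
  have key : ∀ i n : ZMod 3, (n = i ∨ n = i + 1) ∨ n = i - 1 := by decide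
  rcases key (c (τ.symm x)) (c (τ x)) with hn | hn
  · exact h₁ hn
  · obtain ⟨h₃, h₄⟩ := h₂ hn
    rcases Classical.em _ with hN | hN
    · exact absurd (h₃ hN).symm hne
    · exact h₄ hN

/-- if `c` obeys the Example-1 rule at every point, then (a) the colours
cycle forward in the `τ` direction, and (b) `c x = 0` forces `c (σⱼ x) ≠ 0` while
`c x ≠ 0` forces `c (σⱼ x) = 0`. -/
theorem example1_rule_consequences {k : ℕ} (hk : 2 ≤ k) {X : Type*}
    (τ : Equiv.Perm X) (σ : Fin (k - 1) → Equiv.Perm X) (c : X → ZMod 3)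
    (hc : ∀ x : X, ObeysRule τ σ c x) :
    ((∀ x : X, c x = c (τ.symm x) + 1) ∧ ∀ x : X, c (τ x) = c x + 1) ∧
    ∀ (x : X) (j : Fin (k - 1)),
      (c x = 0 → c (σ j x) ≠ 0) ∧ (c x ≠ 0 → c (σ j x) = 0) := by
  have hprev : ∀ x : X, c x = c (τ.symm x) + 1 := fun x =>
    (hc x).eq_add_one (by simpa using (hc (τ x)).apply_ne_apply_symm)
  have hnext : ∀ x : X, c (τ x) = c x + 1 := fun x => by simpa using hprev (τ x)
  refine ⟨⟨hprev, hnext⟩, fun x j => ?_⟩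
  have hτ : c (τ x) = c (τ.symm x) - 1 := by
    rw [hnext, hprev x]
    generalize c (τ.symm x) = i
    revert i
    decide
  have hN := mt ((hc x).2 hτ).1 (by rw [hnext]; generalize c x = i; revert i; decide)
  have hle := Finset.card_filter_le (Finset.univ : Finset (Fin (k - 1))) fun j => c (σ j x) = 0
  rw [Finset.card_univ, Fintype.card_fin] at hle
  have hsymm : c (τ.symm x) = c x - 1 := by rw [hprev x]; ring
  rw [hnext, hsymm] at hN
  constructor
  · intro h0 hj
    have hpos : 0 < (Finset.univ.filter fun j : Fin (k - 1) => c (σ j x) = 0).card :=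
      Finset.card_pos.2 ⟨j, by simpa using hj⟩
    have h1 : ¬ c x + 1 = 0 := by rw [h0]; decide
    have h2 : ¬ c x - 1 = 0 := by rw [h0]; decide
    rw [if_neg h1, if_neg h2] at hN
    omega
  · intro h0
    have hone : ∀ i : ZMod 3, i ≠ 0 →
        (if i + 1 = 0 then 1 else 0) + (if i - 1 = 0 then 1 else 0) = 1 := by decide
    rw [hone _ h0] at hN
    have hcard : (Finset.univ.filter fun j : Fin (k - 1) => c (σ j x) = 0).card =
        (Finset.univ : Finset (Fin (k - 1))).card := by
      rw [Finset.card_univ, Fintype.card_fin]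
      omega
    exact Finset.card_filter_eq_iff.1 hcard j (Finset.mem_univ j)
end

section
/- Suppose the colouring c : X → ℤ/3ℤ satisfies: for every x ∈ X, c(τx) = c(x) + 1 (in ℤ/3ℤ), and for every x ∈ X and every j ∈ {1, …, k−1}, c(x) = 0 if and only if c(σⱼx) ≠ 0. Then c obeys the Example-1 rule at every point of X. -/
/-- if the colours cycle forward in the `τ` direction and
`c x = 0 ↔ c (σⱼ x) ≠ 0` for every `j`, then `c` obeys the Example-1 rule at every
point. -/
theorem example1_rule_of_cyclic_alternating {k : ℕ} (hk : 2 ≤ k) {X : Type*}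
    (τ : Equiv.Perm X) (σ : Fin (k - 1) → Equiv.Perm X) (c : X → ZMod 3)
    (hτ : ∀ x : X, c (τ x) = c x + 1)
    (hσ : ∀ (x : X) (j : Fin (k - 1)), c x = 0 ↔ c (σ j x) ≠ 0) :
    ∀ x : X, ObeysRule τ σ c x := by
  intro x
  have hx : c x = c (τ.symm x) + 1 := by simpa using hτ (τ.symm x)
  refine ⟨fun _ => hx, fun _ => ⟨fun hN => ?_, fun _ => hx⟩⟩
  exfalso
  rw [hτ x] at hN
  have hi : c (τ.symm x) = c x - 1 := by rw [hx]; ring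
  rw [hi] at hN
  by_cases h0 : c x = 0
  · have hσx : ∀ j, c (σ j x) ≠ 0 := fun j => (hσ x j).1 h0
    have h1 : (0 : ZMod 3) + 1 ≠ 0 := by decide
    have h2 : (0 : ZMod 3) - 1 ≠ 0 := by decide
    rw [h0, if_neg h1, if_neg h2, Finset.filter_false_of_mem fun j _ => hσx j] at hN
    simp at hN
  · have hσx : ∀ j, c (σ j x) = 0 := fun j => by
      by_contra h
      exact h0 ((hσ x j).2 h)
    have hone : ∀ a : ZMod 3, a ≠ 0 →
        (if a + 1 = 0 then 1 else 0) + (if a - 1 = 0 then 1 else 0) = 1 := by decide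
    rw [hone _ h0, Finset.filter_true_of_mem fun j _ => hσx j, Finset.card_univ,
      Fintype.card_fin] at hN
    omega
end

section
/- Suppose there exists a cyclic-alternating colouring c : X → ℤ/3ℤ for (τ, σ). Then there is no finitely additive probability measure defined on all subsets of X that is invariant under τ and σ; precisely, there is no function m : Set X → ℝ such that m(S) ≥ 0 for all S ⊆ X, m(X) = 1, m(S ∪ T) = m(S) + m(T) whenever S and T are disjoint, and m(τ(S)) = m(S) and m(σ(S)) = m(S) for all S ⊆ X, where τ(S) and σ(S) denote images of S. -/
/-- if `c : X → ZMod 3` is a cyclic-alternating colouring for the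
bijections `(τ, σ)` (i.e. `c (τ x) = c x + 1` and `c x = 0 ↔ c (σ x) ≠ 0` for all
`x`), then there is no finitely additive probability measure on all subsets of `X`
invariant under `τ` and `σ`. -/
theorem no_invariant_fin_add_measure_of_cyclic_alternating {X : Type*}
    (τ σ : Equiv.Perm X) (c : X → ZMod 3)
    (hτ : ∀ x : X, c (τ x) = c x + 1)
    (hσ : ∀ x : X, c x = 0 ↔ c (σ x) ≠ 0) :
    ¬ ∃ m : Set X → ℝ,
        (∀ S : Set X, 0 ≤ m S) ∧
        m Set.univ = 1 ∧
        (∀ S T : Set X, Disjoint S T → m (S ∪ T) = m S + m T) ∧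
        (∀ S : Set X, m (τ '' S) = m S) ∧
        (∀ S : Set X, m (σ '' S) = m S) := by
  rintro ⟨m, -, huniv, hadd, hmτ, hmσ⟩
  have image_fiber (i : ZMod 3) : τ '' (c ⁻¹' {i}) = c ⁻¹' {i + 1} := by
    ext y
    obtain ⟨x, rfl⟩ := τ.surjective y
    simp [hτ]
  have image_zero : σ '' (c ⁻¹' {0}) = (c ⁻¹' {0})ᶜ := by
    ext y
    obtain ⟨x, rfl⟩ := σ.surjective y
    simpa using hσ x
  have compl_zero : (c ⁻¹' {0})ᶜ = c ⁻¹' {0 + 1} ∪ c ⁻¹' {0 + 1 + 1} := by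
    ext x
    have trichotomy : ∀ i : ZMod 3, i ≠ 0 ↔ i = 0 + 1 ∨ i = 0 + 1 + 1 := by decide
    exact trichotomy (c x)
  have disjoint_one_two : Disjoint (c ⁻¹' {0 + 1}) (c ⁻¹' {0 + 1 + 1}) :=
    Disjoint.preimage c (Set.disjoint_singleton.2 (by decide))
  have total := hadd _ _ (disjoint_compl_right (a := c ⁻¹' {0}))
  rw [Set.union_compl_self, huniv, ← image_zero, hmσ] at total
  have split := hadd _ _ disjoint_one_two
  rw [← compl_zero, ← image_zero, hmσ, ← image_fiber (0 + 1), hmτ, ← image_fiber 0, hmτ] at split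
  linarith
end

section
/- For every integer k ≥ 2 there exists a colouring c : FreeGroup (Fin k) → ℤ/3ℤ such that, writing τ = FreeGroup.of 0 and σⱼ = FreeGroup.of j for each j with 1 ≤ j ≤ k−1, one has for every g ∈ FreeGroup (Fin k): c(τ·g) = c(g) + 1 (in ℤ/3ℤ), and for every j with 1 ≤ j ≤ k−1, c(σⱼ·g) = 0 if and only if c(g) ≠ 0. -/
/-- An involution of `ZMod 3 × ℕ` exchanging the points of colour `0` with those of
nonzero colour. -/
def colourSwap (p : ZMod 3 × ℕ) : ZMod 3 × ℕ :=
  if p.1 = 0 then (if p.2 % 2 = 0 then 1 else 2, p.2 / 2)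
  else (0, 2 * p.2 + if p.1 = 1 then 0 else 1)

theorem colourSwap_fst_eq_zero_iff (p : ZMod 3 × ℕ) : (colourSwap p).1 = 0 ↔ p.1 ≠ 0 := by
  have h1 : (1 : ZMod 3) ≠ 0 := by decide
  have h2 : (2 : ZMod 3) ≠ 0 := by decide
  unfold colourSwap
  split_ifs <;> simp_all

theorem colourSwap_involutive : Function.Involutive colourSwap := by
  have h1 : (1 : ZMod 3) ≠ 0 := by decide
  have h2 : (2 : ZMod 3) ≠ 0 := by decide
  have h21 : (2 : ZMod 3) ≠ 1 := by decide
  have h3 : ∀ a : ZMod 3, a ≠ 0 → a ≠ 1 → a = 2 := by decide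
  rintro ⟨a, n⟩
  by_cases ha : a = 0
  · rcases Nat.mod_two_eq_zero_or_one n with hn | hn <;>
      simp [colourSwap, ha, hn, h1, h2, h21] <;> omega
  · by_cases ha1 : a = 1
    · simp [colourSwap, ha1, h1]
    · have hn : (2 * n + 1) / 2 = n := by omega
      simp [colourSwap, h3 a ha ha1, h2, h21, hn]

/-- for every `k ≥ 2` there is a colouring `c` of the free group on `k`
generators with three colours such that, with `τ = FreeGroup.of 0` and
`σⱼ = FreeGroup.of j` for `1 ≤ j ≤ k - 1`, one has `c (τ * g) = c g + 1` for every
`g`, and `c (σⱼ * g) = 0 ↔ c g ≠ 0` for every `g` and every such `j`. -/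
theorem exists_cyclic_alternating_colouring_freeGroup :
    ∀ (k : ℕ) (hk : 2 ≤ k),
      ∃ c : FreeGroup (Fin k) → ZMod 3,
        ∀ g : FreeGroup (Fin k),
          c (FreeGroup.of (⟨0, by omega⟩ : Fin k) * g) = c g + 1 ∧
          ∀ j : Fin k, 1 ≤ (j : ℕ) →
            (c (FreeGroup.of j * g) = 0 ↔ c g ≠ 0) := by
  intro k hk
  let shift : Equiv.Perm (ZMod 3 × ℕ) := (Equiv.addRight 1).prodCongr (Equiv.refl ℕ)
  let act : FreeGroup (Fin k) →* Equiv.Perm (ZMod 3 × ℕ) :=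
    FreeGroup.lift fun j => if (j : ℕ) = 0 then shift else colourSwap_involutive.toPerm
  refine ⟨fun g => (act g (0, 0)).1, fun g => ⟨?_, fun j hj => ?_⟩⟩
  · simp [act, shift]
  · have hj0 : (j : ℕ) ≠ 0 := by omega
    have h : act (FreeGroup.of j * g) (0, 0) = colourSwap (act g (0, 0)) := by
      rw [map_mul, Equiv.Perm.mul_apply]
      simp only [act, FreeGroup.lift_apply_of, if_neg hj0, Function.Involutive.coe_toPerm]
    change (act (FreeGroup.of j * g) (0, 0)).1 = 0 ↔ _
    rw [h, colourSwap_fst_eq_zero_iff]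
end

section
/- Suppose c : X → ℤ/3ℤ is a cyclic-alternating colouring for (τ, σ). Then X admits a paradoxical decomposition using the subgroup G of the permutation group of X generated by τ and σ: there exist pairwise disjoint sets P₁, P₂, P₃, P₄ ⊆ X with P₁ ∪ P₂ ∪ P₃ ∪ P₄ = X, and elements g₁, g₂, g₃, g₄ ∈ G, such that g₁(P₁) and g₂(P₂) are disjoint with g₁(P₁) ∪ g₂(P₂) = X, and g₃(P₃) and g₄(P₄) are disjoint with g₃(P₃) ∪ g₄(P₄) = X (images of sets under the permutations). In other words, the colour classes of any cyclic-alternating colouring yield a paradoxical decomposition of X. -/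
/-- A permutation `g` maps `{x | p x}` onto `{x | q x}` when `p x` is equivalent to `q (g x)`. -/
theorem Equiv.Perm.image_setOf_eq_of_iff {X : Type*} (g : Equiv.Perm X) {p q : X → Prop}
    (h : ∀ x, p x ↔ q (g x)) : g '' {x | p x} = {x | q x} := by
  ext y
  rw [Set.mem_image_equiv, Set.mem_ofPred_eq, Set.mem_ofPred_eq, h, Equiv.apply_symm_apply]

/-- if `c : X → ZMod 3` is a cyclic-alternating colouring for the
bijections `(τ, σ)` (i.e. `c (τ x) = c x + 1` and `c x = 0 ↔ c (σ x) ≠ 0` for all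
`x`), then `X` admits a paradoxical decomposition using elements of the subgroup of
`Equiv.Perm X` generated by `τ` and `σ`: there are four pairwise disjoint pieces
covering `X` such that suitable group translates of the first two partition `X` and
suitable group translates of the last two also partition `X`. -/
theorem paradoxical_decomposition_of_cyclic_alternating {X : Type*}
    (τ σ : Equiv.Perm X) (c : X → ZMod 3)
    (hτ : ∀ x : X, c (τ x) = c x + 1)
    (hσ : ∀ x : X, c x = 0 ↔ c (σ x) ≠ 0) :
    ∃ (P₁ P₂ P₃ P₄ : Set X) (g₁ g₂ g₃ g₄ : Equiv.Perm X),
      g₁ ∈ Subgroup.closure {τ, σ} ∧ g₂ ∈ Subgroup.closure {τ, σ} ∧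
      g₃ ∈ Subgroup.closure {τ, σ} ∧ g₄ ∈ Subgroup.closure {τ, σ} ∧
      Disjoint P₁ P₂ ∧ Disjoint P₁ P₃ ∧ Disjoint P₁ P₄ ∧
      Disjoint P₂ P₃ ∧ Disjoint P₂ P₄ ∧ Disjoint P₃ P₄ ∧
      P₁ ∪ P₂ ∪ P₃ ∪ P₄ = Set.univ ∧
      Disjoint (g₁ '' P₁) (g₂ '' P₂) ∧ g₁ '' P₁ ∪ g₂ '' P₂ = Set.univ ∧
      Disjoint (g₃ '' P₃) (g₄ '' P₄) ∧ g₃ '' P₃ ∪ g₄ '' P₄ = Set.univ := by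
  have hτ_mem : τ ∈ Subgroup.closure {τ, σ} := Subgroup.subset_closure (by simp)
  have hσ_mem : σ ∈ Subgroup.closure {τ, σ} := Subgroup.subset_closure (by simp)
  have hg_mem := mul_mem hσ_mem (inv_mem hτ_mem)
  have hτ_inv (x : X) : c (τ⁻¹ x) = c x - 1 := by
    simp [eq_sub_iff_add_eq, ← hτ]
  have h_one : (σ * τ⁻¹) '' {x | c x = 1} = {x | c x ≠ 0} :=
    Equiv.Perm.image_setOf_eq_of_iff _ fun x => by
      rw [Equiv.Perm.mul_apply, ← hσ, hτ_inv, sub_eq_zero]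
  have h_two : τ '' {x | c x = 2} = {x | c x = 0} :=
    Equiv.Perm.image_setOf_eq_of_iff _ fun x => by
      rw [hτ]
      generalize c x = a
      revert a
      decide
  have h_conj (g : Equiv.Perm X) (s : Set X) : (g * σ⁻¹) '' (σ '' s) = g '' s := by
    simp [Set.image_image]
  have h_cases (a : ZMod 3) : a = 0 ∨ a = 1 ∨ a = 2 := by
    revert a
    decide
  have h_image (s : Set X) (hs : ∀ x ∈ s, c x ≠ 0) : ∀ y ∈ σ '' s, c y = 0 := by
    rintro _ ⟨x, hx, rfl⟩
    exact not_not.mp fun h => hs x hx ((hσ x).mpr h)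
  have h_ne_one : ∀ x ∈ {x | c x = 1}, c x ≠ 0 := fun x (hx : c x = 1) => by
    rw [hx]; decide
  have h_ne_two : ∀ x ∈ {x | c x = 2}, c x ≠ 0 := fun x (hx : c x = 2) => by
    rw [hx]; decide
  have h_disj : Disjoint {x | c x = 1} {x | c x = 2} :=
    Set.disjoint_left.mpr fun x (h₁ : c x = 1) (h₂ : c x = 2) =>
      absurd (h₁.symm.trans h₂) (by decide)
  have h_disj_image {s t : Set X} (hs : ∀ x ∈ s, c x ≠ 0) (ht : ∀ x ∈ t, c x ≠ 0) :
      Disjoint s (σ '' t) :=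
    Set.disjoint_left.mpr fun x hxs hxt => hs x hxs (h_image t ht x hxt)
  have h_disj_zero : Disjoint {x | c x ≠ 0} {x | c x = 0} :=
    Set.disjoint_left.mpr fun _ h h' => h h'
  have h_union_zero : {x | c x ≠ 0} ∪ {x | c x = 0} = Set.univ :=
    Set.eq_univ_of_forall fun x => (em (c x = 0)).symm
  refine ⟨{x | c x = 1}, {x | c x = 2}, σ '' {x | c x = 1}, σ '' {x | c x = 2},
    σ * τ⁻¹, τ, σ * τ⁻¹ * σ⁻¹, τ * σ⁻¹, hg_mem, hτ_mem, mul_mem hg_mem (inv_mem hσ_mem),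
    mul_mem hτ_mem (inv_mem hσ_mem), h_disj, h_disj_image h_ne_one h_ne_one,
    h_disj_image h_ne_one h_ne_two, h_disj_image h_ne_two h_ne_one,
    h_disj_image h_ne_two h_ne_two, (Set.disjoint_image_iff σ.injective).mpr h_disj,
    Set.eq_univ_of_forall fun x => ?_, ?_⟩
  · rcases h_cases (c x) with h | h | h
    · have hx : c (σ⁻¹ x) ≠ 0 := fun h' => (hσ _).mp h' (by simpa using h)
      rcases (h_cases (c (σ⁻¹ x))).resolve_left hx with h' | h'
      · exact Or.inl (Or.inr ⟨σ⁻¹ x, h', by simp⟩)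
      · exact Or.inr ⟨σ⁻¹ x, h', by simp⟩
    · exact Or.inl (Or.inl (Or.inl h))
    · exact Or.inl (Or.inl (Or.inr h))
  · rw [h_conj, h_conj, h_one, h_two]
    exact ⟨h_disj_zero, h_union_zero, h_disj_zero, h_union_zero⟩
end

section
/- For every function s : F₂ → Bool there exists an injective function f : F₂ → F₂ such that for every g ∈ F₂: |f(g)| = |g| + 1; if s(g) = true then f(g) = a·g or f(g) = b·g; and if s(g) = false then f(g) = a⁻¹·g or f(g) = b⁻¹·g. (This is the existence, for an arbitrary assignment of signs to vertices, of an orientation of arrows on the Cayley graph of F₂ in which every vertex emits one arrow in an allowed direction and no vertex receives two arrows.) -/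
open FreeGroup in
/-- Every element of `F₂` can be extended on the left, without cancellation, by a letter of any
prescribed sign. -/
theorem exists_toWord_mk_singleton_mul (ε : Bool) (g : FreeGroup (Fin 2)) :
    ∃ i : Fin 2, (mk [(i, ε)] * g).toWord = (i, ε) :: g.toWord := by
  suffices h : ∃ i : Fin 2, FreeGroup.IsReduced ((i, ε) :: g.toWord) by
    obtain ⟨i, hi⟩ := h
    refine ⟨i, ?_⟩
    conv_lhs => rw [← mk_toWord (x := g), mul_mk, toWord_mk, List.singleton_append, hi.reduce_eq]
  have hg : FreeGroup.IsReduced g.toWord := isReduced_toWord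
  rcases hw : g.toWord with _ | ⟨⟨j, δ⟩, w⟩
  · exact ⟨0, by simp [FreeGroup.IsReduced]⟩
  · obtain ⟨i, hi⟩ := exists_ne j
    exact ⟨i, isReduced_cons_cons.2 ⟨fun h => absurd h hi, hw ▸ hg⟩⟩

/-- for every assignment of signs `s : F₂ → Bool` on the free group
`F₂` on two generators `a = FreeGroup.of 0`, `b = FreeGroup.of 1`, there is an
injective `f : F₂ → F₂` increasing the norm by one at every point and moving each
`g` with `s g = true` to `a·g` or `b·g`, and each `g` with `s g = false` to `a⁻¹·g`
or `b⁻¹·g`. -/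
theorem exists_injective_orientation (s : FreeGroup (Fin 2) → Bool) :
    ∃ f : FreeGroup (Fin 2) → FreeGroup (Fin 2),
      Function.Injective f ∧
      ∀ g : FreeGroup (Fin 2),
        FreeGroup.norm (f g) = FreeGroup.norm g + 1 ∧
        (s g = true →
          f g = FreeGroup.of (0 : Fin 2) * g ∨ f g = FreeGroup.of (1 : Fin 2) * g) ∧
        (s g = false →
          f g = (FreeGroup.of (0 : Fin 2))⁻¹ * g ∨
          f g = (FreeGroup.of (1 : Fin 2))⁻¹ * g) := by
  choose i hi using fun g => exists_toWord_mk_singleton_mul (s g) g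
  refine ⟨fun g => FreeGroup.mk [(i g, s g)] * g, fun g h hgh => ?_, fun g => ⟨?_, ?_, ?_⟩⟩
  · have hw := congrArg FreeGroup.toWord hgh
    rw [hi, hi] at hw
    exact FreeGroup.toWord_injective (List.cons.inj hw).2
  · simp [FreeGroup.norm, hi]
  · intro hs
    simp only [hs]
    rcases Fin.exists_fin_two.1 ⟨i g, rfl⟩ with h | h
    · exact Or.inl (by rw [← h]; rfl)
    · exact Or.inr (by rw [← h]; rfl)
  · intro hs
    simp only [hs]
    rcases Fin.exists_fin_two.1 ⟨i g, rfl⟩ with h | h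
    · exact Or.inl (by rw [← h]; rfl)
    · exact Or.inr (by rw [← h]; rfl)
end
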